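/- arXiv:2505.22975 — 2 statements merged into one kernel-verified Lean document; each statement's English description precedes it below -/
import Mathlib

section
/- Let c > 0 and let f : [0,c] → ℝ be of class C¹'¹([0,c]) with f'' = h almost everywhere, where h is integrable on [0,c]. Let h₁ : [0,c] → ℝ be continuous with ∫₀^c h₁(t) dt = ∫₀^c h(t) dt and ∫₀^c t·h₁(t) dt = ∫₀^c t·h(t) dt, and define u(x) := f(0) + f'(0)·x + ∫₀^x h₁(t)(x − t) dt for x ∈ [0,c]. Then u is of class C²([0,c]) with u'' = h₁ on [0,c], and u(0) = f(0), u'(0) = f'(0), u(c) = f(c), u'(c) = f'(c). Moreover, if h₁ ≥ 0 on [0,c], then u is convex. -/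
open MeasureTheory Set intervalIntegral

/-- The first derivative of a first-order Taylor polynomial plus integral remainder. -/
theorem hasDerivAt_taylor_integral {g : ℝ → ℝ} (hg : Continuous g) (a b x : ℝ) :
    HasDerivAt (fun y => a + b * y + ∫ t in (0:ℝ)..y, g t * (y - t))
      (b + ∫ t in (0:ℝ)..x, g t) x := by
  have hsplit : (fun y => a + b * y + ∫ t in (0:ℝ)..y, g t * (y - t)) =
      fun y => a + b * y + (y * (∫ t in (0:ℝ)..y, g t) - ∫ t in (0:ℝ)..y, t * g t) := by
    funext y
    rw [← intervalIntegral.integral_const_mul, ← intervalIntegral.integral_sub]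
    · congr 2
      funext t
      ring
    · exact (continuous_const.mul hg).intervalIntegrable _ _
    · exact (continuous_id.mul hg).intervalIntegrable _ _
  have h0 : HasDerivAt (fun y => ∫ t in (0:ℝ)..y, g t) (g x) x :=
    hg.integral_hasStrictDerivAt 0 x |>.hasDerivAt
  have h1 : HasDerivAt (fun y => ∫ t in (0:ℝ)..y, t * g t) (x * g x) x :=
    (continuous_id.mul hg).integral_hasStrictDerivAt 0 x |>.hasDerivAt
  rw [hsplit]
  refine ((((hasDerivAt_id' x).const_mul b).const_add a).add
    (((hasDerivAt_id' x).mul h0).sub h1)).congr_deriv ?_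
  ring

/-- Taylor's formula with integral remainder for a function with Lipschitz derivative:
the zeroth and first moments of the second derivative in terms of boundary values. -/
theorem integral_moments_of_lipschitz_deriv {c : ℝ} (hc : 0 < c) {f f' h : ℝ → ℝ}
    (hderiv : ∀ x ∈ Icc 0 c, HasDerivWithinAt f (f' x) (Icc 0 c) x)
    {K : NNReal} (hlip : LipschitzOnWith K f' (Icc 0 c))
    (hsecond : ∀ᵐ x : ℝ, x ∈ Ioo 0 c → HasDerivAt f' (h x) x) :
    (∫ t in (0:ℝ)..c, h t) = f' c - f' 0 ∧
      (∫ t in (0:ℝ)..c, t * h t) = c * f' c - (f c - f 0) := by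
  have hu : uIcc 0 c = Icc 0 c := uIcc_of_le hc.le
  have hac : AbsolutelyContinuousOnInterval f' 0 c :=
    LipschitzOnWith.absolutelyContinuousOnInterval (by rwa [hu])
  have hid : AbsolutelyContinuousOnInterval (fun x : ℝ => x) 0 c :=
    (LipschitzWith.id.lipschitzOnWith).absolutelyContinuousOnInterval
  have hae : ∀ᵐ x : ℝ, x ∈ Set.uIoc 0 c → deriv f' x = h x := by
    filter_upwards [hsecond, compl_mem_ae_iff.mpr (measure_singleton c)] with x hx hxc hxm
    rw [uIoc_of_le hc.le] at hxm
    exact (hx ⟨hxm.1, lt_of_le_of_ne hxm.2 hxc⟩).deriv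
  have hf : (∫ t in (0:ℝ)..c, f' t) = f c - f 0 := by
    refine integral_eq_sub_of_hasDerivAt_of_le hc.le
      (fun x hx => (hderiv x hx).continuousWithinAt)
      (fun x hx => (hderiv x (Ioo_subset_Icc_self hx)).hasDerivAt (Icc_mem_nhds hx.1 hx.2)) ?_
    exact (hac.continuousOn).intervalIntegrable
  constructor
  · rw [← hac.integral_deriv_eq_sub]
    exact (intervalIntegral.integral_congr_ae hae).symm
  · have := hid.integral_mul_deriv_eq_deriv_mul hac
    simp only [deriv_id'', one_mul, zero_mul, sub_zero, hf] at this
    rw [← this]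
    refine (intervalIntegral.integral_congr_ae ?_).symm
    filter_upwards [hae] with x hx hxm
    rw [hx hxm]

/-- **Formula (15).** If `f ∈ C¹'¹([0,c])` with `f'' = h` a.e., `h` integrable, and
`h₁ ∈ C([0,c])` has the same zeroth and first moments as `h` on `[0,c]`, then
`u(x) := f(0) + f'(0)x + ∫₀ˣ h₁(t)(x−t) dt` is `C²([0,c])` with `u'' = h₁`, agrees with
`f` and `f'` at `0` and `c`, and is convex whenever `h₁ ≥ 0`. -/
theorem second_antiderivative_matching (c : ℝ) (hc : 0 < c) (f f' h h₁ : ℝ → ℝ)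
    (hderiv : ∀ x ∈ Icc 0 c, HasDerivWithinAt f (f' x) (Icc 0 c) x)
    (K : NNReal) (hlip : LipschitzOnWith K f' (Icc 0 c))
    (hsecond : ∀ᵐ x : ℝ, x ∈ Ioo 0 c → HasDerivAt f' (h x) x)
    (hint : IntegrableOn h (Icc 0 c))
    (hcont : ContinuousOn h₁ (Icc 0 c))
    (hmom0 : (∫ t in (0:ℝ)..c, h₁ t) = ∫ t in (0:ℝ)..c, h t)
    (hmom1 : (∫ t in (0:ℝ)..c, t * h₁ t) = ∫ t in (0:ℝ)..c, t * h t) :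
    ∃ u' : ℝ → ℝ,
      (∀ x ∈ Icc 0 c,
        HasDerivWithinAt (fun y => f 0 + f' 0 * y + ∫ t in (0:ℝ)..y, h₁ t * (y - t))
          (u' x) (Icc 0 c) x) ∧
      (∀ x ∈ Icc 0 c, HasDerivWithinAt u' (h₁ x) (Icc 0 c) x) ∧
      ContDiffOn ℝ 2 (fun y => f 0 + f' 0 * y + ∫ t in (0:ℝ)..y, h₁ t * (y - t)) (Icc 0 c) ∧
      (f 0 + f' 0 * 0 + ∫ t in (0:ℝ)..(0:ℝ), h₁ t * (0 - t)) = f 0 ∧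
      u' 0 = f' 0 ∧
      (f 0 + f' 0 * c + ∫ t in (0:ℝ)..c, h₁ t * (c - t)) = f c ∧
      u' c = f' c ∧
      ((∀ t ∈ Icc 0 c, 0 ≤ h₁ t) →
        ConvexOn ℝ (Icc 0 c) (fun y => f 0 + f' 0 * y + ∫ t in (0:ℝ)..y, h₁ t * (y - t))) := by
  set u : ℝ → ℝ := fun y => f 0 + f' 0 * y + ∫ t in (0:ℝ)..y, h₁ t * (y - t) with hu
  obtain ⟨g, hg, hgh⟩ : ∃ g : ℝ → ℝ, Continuous g ∧ EqOn g h₁ (Icc 0 c) :=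
    ⟨IccExtend hc.le ((Icc 0 c).domRestrict h₁), hcont.domRestrict.Icc_extend',
      fun x hx => IccExtend_of_mem hc.le _ hx⟩
  have hsub : ∀ x ∈ Icc 0 c, uIcc 0 x ⊆ Icc 0 c := fun x hx =>
    uIcc_of_le hx.1 ▸ Icc_subset_Icc_right hx.2
  have hu_eq : EqOn u (fun y => f 0 + f' 0 * y + ∫ t in (0:ℝ)..y, g t * (y - t)) (Icc 0 c) := by
    intro y hy
    simp only [hu]
    congr 1
    exact intervalIntegral.integral_congr fun t ht => by simp only [hgh (hsub y hy ht)]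
  have hu1 : ∀ x ∈ Icc 0 c,
      HasDerivWithinAt u (f' 0 + ∫ t in (0:ℝ)..x, g t) (Icc 0 c) x := fun x hx =>
    (hasDerivAt_taylor_integral hg _ _ x).hasDerivWithinAt.congr_of_mem hu_eq hx
  have hu2 : ∀ x ∈ Icc 0 c,
      HasDerivWithinAt (fun y => f' 0 + ∫ t in (0:ℝ)..y, g t) (h₁ x) (Icc 0 c) x := by
    intro x hx
    rw [← hgh hx]
    exact ((hg.integral_hasStrictDerivAt 0 x).hasDerivAt.const_add _).hasDerivWithinAt
  have hgc : (∫ t in (0:ℝ)..c, g t) = ∫ t in (0:ℝ)..c, h₁ t :=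
    intervalIntegral.integral_congr fun t ht => hgh (hsub c (right_mem_Icc.2 hc.le) ht)
  obtain ⟨hm0, hm1⟩ := integral_moments_of_lipschitz_deriv hc hderiv hlip hsecond
  have hint₁ : IntervalIntegrable h₁ volume 0 c :=
    ContinuousOn.intervalIntegrable (by rwa [uIcc_of_le hc.le])
  refine ⟨fun y => f' 0 + ∫ t in (0:ℝ)..y, g t, hu1, hu2, ?_, by simp, by simp, ?_, ?_, ?_⟩
  · refine ContDiff.contDiffOn ?_ |>.congr hu_eq
    have hd := fun x => hasDerivAt_taylor_integral hg (f 0) (f' 0) x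
    have hd' : ∀ x, HasDerivAt (fun y => f' 0 + ∫ t in (0:ℝ)..y, g t) (g x) x := fun x =>
      (hg.integral_hasStrictDerivAt 0 x).hasDerivAt.const_add _
    rw [show (2 : WithTop ℕ∞) = 1 + 1 by norm_num, contDiff_succ_iff_deriv]
    refine ⟨fun x => (hd x).differentiableAt, by simp, ?_⟩
    rw [funext fun x => (hd x).deriv, contDiff_one_iff_deriv, funext fun x => (hd' x).deriv]
    exact ⟨fun x => (hd' x).differentiableAt, hg⟩
  · have hsplit : (∫ t in (0:ℝ)..c, h₁ t * (c - t)) =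
        c * (∫ t in (0:ℝ)..c, h₁ t) - ∫ t in (0:ℝ)..c, t * h₁ t := by
      rw [← intervalIntegral.integral_const_mul, ← intervalIntegral.integral_sub (hint₁.const_mul c)
        (hint₁.continuousOn_mul (continuous_id'.continuousOn))]
      congr 1
      funext t
      ring
    rw [hsplit, hmom0, hmom1, hm0, hm1]
    ring
  · simp only [hgc, hmom0, hm0]
    ring
  · intro hnn
    refine convexOn_of_hasDerivWithinAt2_nonneg (convex_Icc 0 c)
      (fun x hx => (hu1 x hx).continuousWithinAt)
      (fun x hx => (hu1 x (interior_subset hx)).mono interior_subset)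
      (fun x hx => (hu2 x (interior_subset hx)).mono interior_subset)
      (fun x hx => hnn x (interior_subset hx))
end

section
/- Let f : ℝ² → ℝ be defined by f(x,y) = |x|. If g : ℝ² → ℝ is convex and the set {(x,y) ∈ ℝ² : f(x,y) ≠ g(x,y)} has finite Lebesgue measure, then g = f everywhere on ℝ². -/
open MeasureTheory

/-- A convex function on `ℝ` that equals `c` outside a set of finite Lebesgue measure equals `c`
everywhere. -/
theorem ConvexOn.eq_const_of_volume_ne_lt_top {h : ℝ → ℝ} {c : ℝ} (hh : ConvexOn ℝ Set.univ h)
    (hfin : volume {y | c ≠ h y} < ⊤) (y : ℝ) : h y = c := by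
  have right (z : ℝ) : ∃ b, z < b ∧ h b = c := by
    by_contra! H
    have hsub : Set.Ioi z ⊆ {y | c ≠ h y} := fun b hb => (H b hb).symm
    exact hfin.not_ge (by simpa using measure_mono (μ := volume) hsub)
  have left (z : ℝ) : ∃ a, a < z ∧ h a = c := by
    by_contra! H
    have hsub : Set.Iio z ⊆ {y | c ≠ h y} := fun a ha => (H a ha).symm
    exact hfin.not_ge (by simpa using measure_mono (μ := volume) hsub)
  obtain ⟨a, hay, ha⟩ := left y
  obtain ⟨b, hyb, hb⟩ := right y
  obtain ⟨d, hbd, hd⟩ := right b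
  have h₁ := hh.slope_mono_adjacent (Set.mem_univ a) (Set.mem_univ b) hay hyb
  have h₂ := hh.slope_mono_adjacent (Set.mem_univ y) (Set.mem_univ d) hyb hbd
  rw [ha, hb, div_le_div_iff₀ (by linarith) (by linarith)] at h₁
  rw [hb, hd, sub_self, zero_div, div_le_iff₀ (by linarith)] at h₂
  nlinarith

/-- If `g : ℝ² → ℝ` is convex and `{(x,y) : g(x,y) ≠ |x|}` has finite Lebesgue measure,
then `g(x,y) = |x|` everywhere. -/
theorem convex_eq_abs_of_finite_difference (g : ℝ × ℝ → ℝ)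
    (hg : ConvexOn ℝ Set.univ g)
    (hfin : volume {p : ℝ × ℝ | |p.1| ≠ g p} < ⊤) :
    ∀ p : ℝ × ℝ, g p = |p.1| := by
  have hcont : Continuous g :=
    continuousOn_univ.1 (hg.continuousOn isOpen_univ)
  have hmeas : MeasurableSet {p : ℝ × ℝ | |p.1| ≠ g p} :=
    (isOpen_ne_fun (by fun_prop) hcont).measurableSet
  rw [Measure.volume_eq_prod] at hfin
  have hae : ∀ᵐ x : ℝ, ∀ y, g (x, y) = |x| := by
    filter_upwards [Measure.ae_measure_lt_top hmeas hfin.ne] with x hx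
    refine ConvexOn.eq_const_of_volume_ne_lt_top (h := fun y => g (x, y)) ?_ hx
    refine ⟨convex_univ, fun y _ z _ a b ha hb hab => ?_⟩
    have key := hg.2 (Set.mem_univ (x, y)) (Set.mem_univ (x, z)) ha hb hab
    have hx' : a * x + b * x = x := by rw [← add_mul, hab, one_mul]
    simpa [hx'] using key
  rintro ⟨x, y⟩
  have heq : (fun x : ℝ => g (x, y)) =ᵐ[volume] fun x => |x| := hae.mono fun x hx => hx y
  exact congrFun (((hcont.comp (by fun_prop : Continuous fun x : ℝ => (x, y))).ae_eq_iff_eq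
    volume continuous_abs).1 heq) x
end
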